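/- The singular locus of the quartic Q₂ consists of exactly the two points [0:0:1] and [1:−1:0]; that is, the set of points of ℙ² at which all three partial derivatives ∂Q₂/∂x, ∂Q₂/∂y, ∂Q₂/∂z vanish equals {[0:0:1], [1:−1:0]}. -/

import Mathlib

noncomputable section

open MvPolynomial

/-- the complex projective plane -/
abbrev P2 := Projectivization ℂ (Fin 3 → ℂ)

instance : TopologicalSpace P2 :=
  inferInstanceAs (TopologicalSpace (Quotient (projectivizationSetoid ℂ (Fin 3 → ℂ))))

/-- the zero locus in ℙ² of a homogeneous polynomial F: the set of points all of whose
representative vectors are zeros of F -/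
def VV (F : MvPolynomial (Fin 3) ℂ) : Set P2 :=
  {P | ∀ (v : Fin 3 → ℂ) (h : v ≠ 0), Projectivization.mk ℂ v h = P → eval v F = 0}

/-- the singular locus of the curve {F = 0}: points at which all three partial
derivatives of F vanish (at every representative vector) -/
def SingLoc (F : MvPolynomial (Fin 3) ℂ) : Set P2 :=
  {P | ∀ (v : Fin 3 → ℂ) (h : v ≠ 0), Projectivization.mk ℂ v h = P →
    ∀ i : Fin 3, eval v (pderiv i F) = 0}

/-- the conic F₁ = 8z²−20yz+36xz+17y²−18xy -/
def F₁ : MvPolynomial (Fin 3) ℂ :=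
  8 * X 2 ^ 2 - 20 * X 1 * X 2 + 36 * X 0 * X 2 + 17 * X 1 ^ 2 - 18 * X 0 * X 1

/-- the quartic Q₁ = 8x²z²−16xy²z+52x²yz−36x³z−37x²y²+18x³y−y⁴+20xy³ -/
def Q₁ : MvPolynomial (Fin 3) ℂ :=
  8 * X 0 ^ 2 * X 2 ^ 2 - 16 * X 0 * X 1 ^ 2 * X 2 + 52 * X 0 ^ 2 * X 1 * X 2
    - 36 * X 0 ^ 3 * X 2 - 37 * X 0 ^ 2 * X 1 ^ 2 + 18 * X 0 ^ 3 * X 1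
    - X 1 ^ 4 + 20 * X 0 * X 1 ^ 3

/-- the conic F₂ = 3x²+2xy+108z² -/
def F₂ : MvPolynomial (Fin 3) ℂ :=
  3 * X 0 ^ 2 + 2 * X 0 * X 1 + 108 * X 2 ^ 2

/-- the quartic Q₂ = 2xy³+3x²y²+108y²z²−x⁴ -/
def Q₂ : MvPolynomial (Fin 3) ℂ :=
  2 * X 0 * X 1 ^ 3 + 3 * X 0 ^ 2 * X 1 ^ 2 + 108 * X 1 ^ 2 * X 2 ^ 2 - X 0 ^ 4

theorem v100_ne : (![1, 0, 0] : Fin 3 → ℂ) ≠ 0 := by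
  intro h; have := congrFun h 0; simp at this

theorem v010_ne : (![0, 1, 0] : Fin 3 → ℂ) ≠ 0 := by
  intro h; have := congrFun h 1; simp at this

theorem v001_ne : (![0, 0, 1] : Fin 3 → ℂ) ≠ 0 := by
  intro h; have := congrFun h 2; simp at this

theorem v110_ne : (![1, 1, 0] : Fin 3 → ℂ) ≠ 0 := by
  intro h; have := congrFun h 0; simp at this

theorem v1m10_ne : (![1, -1, 0] : Fin 3 → ℂ) ≠ 0 := by
  intro h; have := congrFun h 0; simp at this

theorem eval_pderiv_Q₂ (v : Fin 3 → ℂ) :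
    eval v (pderiv 0 Q₂) = 2 * v 1 ^ 3 + 6 * v 0 * v 1 ^ 2 - 4 * v 0 ^ 3 ∧
    eval v (pderiv 1 Q₂) = 6 * v 1 * (v 0 * v 1 + v 0 ^ 2 + 36 * v 2 ^ 2) ∧
    eval v (pderiv 2 Q₂) = 216 * v 1 ^ 2 * v 2 := by
  have pderiv_ofNat (i : Fin 3) (n : ℕ) [n.AtLeastTwo] :
      pderiv i (OfNat.ofNat n : MvPolynomial (Fin 3) ℂ) = 0 :=
    Derivation.map_natCast (pderiv i) n
  refine ⟨?_, ?_, ?_⟩ <;>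
  · simp [Q₂, pderiv_X, pderiv_ofNat, Derivation.leibniz, Derivation.leibniz_pow]
    ring

/-- Off the origin, the gradient of `Q₂` vanishes exactly on the lines spanned by `(0, 0, 1)`
and `(1, -1, 0)`. -/
theorem forall_eval_pderiv_Q₂_eq_zero_iff {v : Fin 3 → ℂ} :
    (∀ i, eval v (pderiv i Q₂) = 0) ↔
      (v 0 = 0 ∧ v 1 = 0) ∨ (v 1 = -v 0 ∧ v 2 = 0) := by
  obtain ⟨h0, h1, h2⟩ := eval_pderiv_Q₂ v
  simp only [Fin.forall_fin_succ, IsEmpty.forall_iff, and_true, Fin.succ_zero_eq_one,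
    Fin.succ_one_eq_two, h0, h1, h2]
  constructor
  · rintro ⟨hx, hy, hz⟩
    by_cases hv : v 1 = 0
    · left
      simpa [hv] using hx
    · have hv2 : v 2 = 0 := by simpa [hv] using hz
      have hv0 : v 0 * (v 1 + v 0) = 0 := by
        have h : v 0 * v 1 + v 0 ^ 2 = 0 := by simpa [hv, hv2] using hy
        linear_combination h
      rcases mul_eq_zero.mp hv0 with h | h
      · simp [h, hv] at hx
      · exact Or.inr ⟨eq_neg_of_add_eq_zero_left h, hv2⟩
  · rintro (⟨hx, hy⟩ | ⟨hy, hz⟩)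
    · simp [hx, hy]
    · rw [hy, hz]
      refine ⟨?_, ?_, ?_⟩ <;> ring

theorem mk_eq_mk_001_iff {v : Fin 3 → ℂ} (hv : v ≠ 0) :
    Projectivization.mk ℂ v hv = Projectivization.mk ℂ ![0, 0, 1] v001_ne ↔
      v 0 = 0 ∧ v 1 = 0 := by
  rw [Projectivization.mk_eq_mk_iff']
  constructor
  · rintro ⟨a, rfl⟩
    simp
  · rintro ⟨h0, h1⟩
    refine ⟨v 2, ?_⟩
    ext i
    fin_cases i <;> simp [h0, h1]

theorem mk_eq_mk_1m10_iff {v : Fin 3 → ℂ} (hv : v ≠ 0) :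
    Projectivization.mk ℂ v hv = Projectivization.mk ℂ ![1, -1, 0] v1m10_ne ↔
      v 1 = -v 0 ∧ v 2 = 0 := by
  rw [Projectivization.mk_eq_mk_iff']
  constructor
  · rintro ⟨a, rfl⟩
    simp
  · rintro ⟨h1, h2⟩
    refine ⟨v 0, ?_⟩
    ext i
    fin_cases i <;> simp [h1, h2]

/-- The singular locus of the quartic Q₂ consists of exactly the two points
[0:0:1] and [1:−1:0]. -/
theorem stmt_14 :
    SingLoc Q₂ = {Projectivization.mk ℂ ![0, 0, 1] v001_ne,
      Projectivization.mk ℂ ![1, -1, 0] v1m10_ne} := by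
  ext P
  have key (v : Fin 3 → ℂ) (hv : v ≠ 0) : (∀ i, eval v (pderiv i Q₂) = 0) ↔
      Projectivization.mk ℂ v hv ∈ ({Projectivization.mk ℂ ![0, 0, 1] v001_ne,
        Projectivization.mk ℂ ![1, -1, 0] v1m10_ne} : Set P2) := by
    rw [forall_eval_pderiv_Q₂_eq_zero_iff, Set.mem_insert_iff, Set.mem_singleton_iff,
      mk_eq_mk_001_iff hv, mk_eq_mk_1m10_iff hv]
  constructor
  · intro hP
    rw [← P.mk_rep, ← key]
    exact hP P.rep P.rep_nonzero P.mk_rep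
  · rintro hP v hv rfl
    exact (key v hv).mpr hP
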